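/- Let Ω ⊆ ℝ³ be a domain convex in the directions of the lines L₁ and L₂, and assume that at least one number in each of the pairs (a₁, b₁) and (a₂, b₂) lies in ℂ∖ℝ. Then every right-G-monogenic mapping Φ : Ω_ζ → ℍ(ℂ) has the form Φ(ζ) = F₁(ξ₁)e₁ + F₂(ξ₂)e₂ + F₃(ξ₁)e₃ + F₄(ξ₂)e₄ for all ζ = x i₁ + y i₂ + z i₃ ∈ Ω_ζ, where F₁ and F₃ are analytic functions on D₁ of the variable ξ₁ = x + y a₁ + z b₁, and F₂ and F₄ are analytic functions on D₂ of the variable ξ₂ = x + y a₂ + z b₂. -/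

import Mathlib

open Filter Set Topology Quaternion

noncomputable section

abbrev HC : Type := ℍ[ℂ, -1, -1]

/-- The idempotent `e₁ = (1 + iI)/2`. -/
def e1 : HC := ⟨1/2, Complex.I/2, 0, 0⟩
/-- The idempotent `e₂ = (1 - iI)/2`. -/
def e2 : HC := ⟨1/2, -(Complex.I/2), 0, 0⟩
/-- `e₃ = (iJ - K)/2`. -/
def e3 : HC := ⟨0, 0, Complex.I/2, -(1/2)⟩
/-- `e₄ = (iJ + K)/2`. -/
def e4 : HC := ⟨0, 0, Complex.I/2, 1/2⟩

/-- Topology on `ℍ(ℂ)` induced from the four complex coordinates. -/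
instance : TopologicalSpace HC :=
  TopologicalSpace.induced (fun q : HC => (q.re, q.imI, q.imJ, q.imK)) inferInstance

/-- Coordinate of `a ∈ ℍ(ℂ)` at `e₁` in the basis `{e₁, e₂, e₃, e₄}`. -/
def c1 (a : HC) : ℂ := a.re - Complex.I * a.imI
/-- Coordinate at `e₂`. -/
def c2 (a : HC) : ℂ := a.re + Complex.I * a.imI
/-- Coordinate at `e₃`. -/
def c3 (a : HC) : ℂ := -(Complex.I * a.imJ) - a.imK
/-- Coordinate at `e₄`. -/
def c4 (a : HC) : ℂ := -(Complex.I * a.imJ) + a.imK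

/-- The norm `‖a‖ = √(|a₁|² + |a₂|² + |a₃|² + |a₄|²)`, coordinates in the basis `{e₁,e₂,e₃,e₄}`. -/
def qnorm (a : HC) : ℝ :=
  Real.sqrt (‖c1 a‖ ^ 2 + ‖c2 a‖ ^ 2 +
    ‖c3 a‖ ^ 2 + ‖c4 a‖ ^ 2)

/-- `f₁ : ℍ(ℂ) → ℂ`, the ℂ-linear functional with `f₁(e₁) = f₁(e₃) = 1`, `f₁(e₂) = f₁(e₄) = 0`. -/
def f1 (a : HC) : ℂ := c1 a + c3 a
/-- `f₂ : ℍ(ℂ) → ℂ`, with `f₂(e₂) = f₂(e₄) = 1`, `f₂(e₁) = f₂(e₃) = 0`. -/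
def f2 (a : HC) : ℂ := c2 a + c4 a
/-- `f̂₁ : ℍ(ℂ) → ℂ`, with `f̂₁(e₁) = f̂₁(e₄) = 1`, `f̂₁(e₂) = f̂₁(e₃) = 0`. -/
def fh1 (a : HC) : ℂ := c1 a + c4 a
/-- `f̂₂ : ℍ(ℂ) → ℂ`, with `f̂₂(e₂) = f̂₂(e₃) = 1`, `f̂₂(e₁) = f̂₂(e₄) = 0`. -/
def fh2 (a : HC) : ℂ := c2 a + c3 a

/-- `ζ = x i₁ + y i₂ + z i₃` for `p = (x, y, z) ∈ ℝ³` (with `i₁ = 1`). -/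
def zeta (i2 i3 : HC) (p : ℝ × ℝ × ℝ) : HC :=
  (p.1 : ℂ) • (1 : HC) + (p.2.1 : ℂ) • i2 + (p.2.2 : ℂ) • i3

/-- The real linear span `E₃` of `i₁ = 1, i₂, i₃`. -/
def E3 (i2 i3 : HC) : Set HC := Set.range (zeta i2 i3)

/-- `i₁ = 1, i₂, i₃` are linearly independent over `ℝ`. -/
def LinIndep (i2 i3 : HC) : Prop :=
  ∀ α₁ α₂ α₃ : ℝ, (α₁ : ℂ) • (1 : HC) + (α₂ : ℂ) • i2 + (α₃ : ℂ) • i3 = 0 →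
    α₁ = 0 ∧ α₂ = 0 ∧ α₃ = 0

/-- `Φ` is right-G-monogenic on `S` (w.r.t. directions in `E₃`): it is continuous on `S` and at
every `ζ ∈ S` there is `Φ'(ζ)` with `lim_{ε→0+} (Φ(ζ+εh) − Φ(ζ))ε⁻¹ = h·Φ'(ζ)` for all `h ∈ E₃`. -/
def RightGMonogenic (i2 i3 : HC) (Φ : HC → HC) (S : Set HC) : Prop :=
  ContinuousOn Φ S ∧ ∀ ζ ∈ S, ∃ Φ' : HC, ∀ h ∈ E3 i2 i3,
    Tendsto (fun ε : ℝ => ((ε : ℂ))⁻¹ • (Φ (ζ + (ε : ℂ) • h) - Φ ζ))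
      (nhdsWithin 0 (Set.Ioi 0)) (nhds (h * Φ'))

/-- `Φ̂` is left-G-monogenic on `S`. -/
def LeftGMonogenic (i2 i3 : HC) (Φ : HC → HC) (S : Set HC) : Prop :=
  ContinuousOn Φ S ∧ ∀ ζ ∈ S, ∃ Φ' : HC, ∀ h ∈ E3 i2 i3,
    Tendsto (fun ε : ℝ => ((ε : ℂ))⁻¹ • (Φ (ζ + (ε : ℂ) • h) - Φ ζ))
      (nhdsWithin 0 (Set.Ioi 0)) (nhds (Φ' * h))

/-- The right maximal ideal `𝓘₁ = {λ₂e₂ + λ₄e₄}`. -/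
def I1 : Set HC := {a | ∃ l2 l4 : ℂ, a = l2 • e2 + l4 • e4}
/-- The right maximal ideal `𝓘₂ = {λ₁e₁ + λ₃e₃}`. -/
def I2 : Set HC := {a | ∃ l1 l3 : ℂ, a = l1 • e1 + l3 • e3}
/-- The left maximal ideal `𝓘̂₁ = {λ₂e₂ + λ₃e₃}`. -/
def Ih1 : Set HC := {a | ∃ l2 l3 : ℂ, a = l2 • e2 + l3 • e3}
/-- The left maximal ideal `𝓘̂₂ = {λ₁e₁ + λ₄e₄}`. -/
def Ih2 : Set HC := {a | ∃ l1 l4 : ℂ, a = l1 • e1 + l4 • e4}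

/-- The line `L` in `ℝ³` given by `x + y·Re a + z·Re b = 0`, `y·Im a + z·Im b = 0`. -/
def lineL (a b : ℂ) : Set (ℝ × ℝ × ℝ) :=
  {p | p.1 + p.2.1 * a.re + p.2.2 * b.re = 0 ∧ p.2.1 * a.im + p.2.2 * b.im = 0}

/-- `Ω` is convex in the direction of the line `L` (a line through the origin): it contains every
segment parallel to `L` joining two of its points. -/
def ConvexInDirection (Ω : Set (ℝ × ℝ × ℝ)) (L : Set (ℝ × ℝ × ℝ)) : Prop :=
  ∀ p ∈ Ω, ∀ q ∈ Ω, q - p ∈ L → segment ℝ p q ⊆ Ω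

/-- `ξ = x + y·a + z·b` for `p = (x,y,z)`. -/
def xi (a b : ℂ) (p : ℝ × ℝ × ℝ) : ℂ := (p.1 : ℂ) + (p.2.1 : ℂ) * a + (p.2.2 : ℂ) * b


/-- `Φ'` is a right Gateaux derivative of `Φ` on `S` (directions in `E₃`). -/
def IsRightGDeriv (i2 i3 : HC) (Φ Φ' : HC → HC) (S : Set HC) : Prop :=
  ∀ ζ ∈ S, ∀ h ∈ E3 i2 i3,
    Tendsto (fun ε : ℝ => ((ε : ℂ))⁻¹ • (Φ (ζ + (ε : ℂ) • h) - Φ ζ))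
      (nhdsWithin 0 (Set.Ioi 0)) (nhds (h * Φ' ζ))

/-- `Φ'` is a left Gateaux derivative of `Φ` on `S`. -/
def IsLeftGDeriv (i2 i3 : HC) (Φ Φ' : HC → HC) (S : Set HC) : Prop :=
  ∀ ζ ∈ S, ∀ h ∈ E3 i2 i3,
    Tendsto (fun ε : ℝ => ((ε : ℂ))⁻¹ • (Φ (ζ + (ε : ℂ) • h) - Φ ζ))
      (nhdsWithin 0 (Set.Ioi 0)) (nhds (Φ' ζ * h))

/-- Triples `(α, β, γ)` of naturals with `α + β + γ = n`. -/
def trip (n : ℕ) : Finset (ℕ × ℕ × ℕ) :=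
  (Finset.range (n + 1) ×ˢ Finset.range (n + 1) ×ˢ Finset.range (n + 1)).filter
    (fun u => u.1 + u.2.1 + u.2.2 = n)

/-- Auxiliary barrier-weighted difference quotient. -/
def lmF (f : ℂ → ℂ) (ε : ℝ) (w : ℂ) : ℂ :=
  f w / w * Complex.exp (-(ε : ℂ) * (-w) ^ ((-(1/4) : ℝ) : ℂ))

lemma lmF_norm (f : ℂ → ℂ) (ε : ℝ) (w : ℂ) (hw : w ≠ 0) :
    ‖lmF f ε w‖ = ‖f w‖ / ‖w‖ *
      Real.exp (-(ε * (‖w‖ ^ (-(1/4) : ℝ) * Real.cos (Real.arccos ((-w).re / ‖-w‖) * (1/4))))) := by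
  have h1 : Real.arccos ((-w).re / ‖-w‖) = |Complex.arg (-w)| := by
    rw [← Complex.cos_arg (neg_ne_zero.mpr hw), ← Real.cos_abs]
    exact Real.arccos_cos (abs_nonneg _) (Complex.abs_arg_le_pi _)
  have h2 : Real.cos (|Complex.arg (-w)| * (1/4)) = Real.cos (Complex.arg (-w) * (-(1/4))) := by
    rw [← Real.cos_abs (Complex.arg (-w) * (-(1/4))), abs_mul]
    norm_num
  unfold lmF
  rw [norm_mul, norm_div, Complex.norm_exp, h1, h2]
  congr 2
  rw [neg_mul, Complex.neg_re, Complex.re_ofReal_mul, Complex.cpow_ofReal_re, norm_neg]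

lemma lmF_norm_le (f : ℂ → ℂ) (ε : ℝ) (hε : 0 < ε) (w : ℂ) (hw : w ≠ 0) :
    ‖lmF f ε w‖ ≤ ‖f w‖ / ‖w‖ * Real.exp (-(ε / 2) * ‖w‖ ^ (-(1/4) : ℝ)) := by
  rw [lmF_norm f ε w hw]
  have hc : (1/2 : ℝ) ≤ Real.cos (Real.arccos ((-w).re / ‖-w‖) * (1/4)) := by
    rw [← Real.cos_pi_div_three]
    apply Real.cos_le_cos_of_nonneg_of_le_pi
    · have := Real.arccos_nonneg ((-w).re / ‖-w‖); positivity
    · linarith [Real.pi_pos]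
    · linarith [Real.arccos_le_pi ((-w).re / ‖-w‖), Real.pi_pos]
  have hp : 0 ≤ ‖w‖ ^ (-(1/4) : ℝ) := by positivity
  gcongr
  nlinarith [mul_le_mul_of_nonneg_left hc (mul_nonneg hε.le hp)]

lemma lmF_norm_le' (f : ℂ → ℂ) (ε : ℝ) (hε : 0 < ε) (w : ℂ) :
    ‖lmF f ε w‖ ≤ ‖f w‖ / ‖w‖ := by
  by_cases hw : w = 0
  · subst hw; simp [lmF]
  refine (lmF_norm_le f ε hε w hw).trans ?_
  have hp : 0 ≤ ‖w‖ ^ (-(1/4) : ℝ) := by positivity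
  apply mul_le_of_le_one_right (by positivity)
  rw [Real.exp_le_one_iff]
  nlinarith

lemma lmF_cont (f : ℂ → ℂ) (ε : ℝ) (hε : 0 < ε) (r : ℝ)
    (hf : ContinuousOn f (Metric.closedBall 0 r)) :
    ContinuousOn (fun w => ‖lmF f ε w‖) (Metric.closedBall 0 r) := by
  intro w hw
  by_cases h0 : w = 0
  · subst h0
    have hz : ‖lmF f ε 0‖ = 0 := by simp [lmF]
    obtain ⟨B, hB⟩ := (isCompact_closedBall (0 : ℂ) r).exists_bound_of_continuousOn hf
    have hB0 : 0 ≤ B := (norm_nonneg _).trans (hB 0 hw)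
    have hlim : Tendsto (fun x : ℝ => B * (x ^ (4 : ℝ) * Real.exp (-(ε/2) * x))) atTop (𝓝 0) := by
      simpa using (tendsto_rpow_mul_exp_neg_mul_atTop_nhds_zero 4 (ε/2) (by positivity)).const_mul B
    have hx : Tendsto (fun w : ℂ => ‖w‖ ^ (-(1/4) : ℝ)) (𝓝[≠] 0) atTop := by
      have h1 : Tendsto (fun w : ℂ => ‖w‖) (𝓝[≠] 0) (𝓝[>] 0) := tendsto_norm_nhdsNE_zero
      exact (tendsto_rpow_neg_nhdsGT_zero (by norm_num)).comp h1
    have h3 := hlim.comp hx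
    have key : Tendsto (fun w => ‖lmF f ε w‖) (𝓝[Metric.closedBall 0 r \ {0}] 0) (𝓝 0) := by
      refine squeeze_zero' (Eventually.of_forall fun _ => norm_nonneg _) ?_
        (h3.mono_left (nhdsWithin_mono _ (fun x hx => hx.2)))
      filter_upwards [self_mem_nhdsWithin] with x hx
      have hx0 : x ≠ 0 := hx.2
      have hn : 0 < ‖x‖ := norm_pos_iff.mpr hx0
      refine (lmF_norm_le f ε hε x hx0).trans ?_
      have : (‖x‖ ^ (-(1/4) : ℝ)) ^ (4:ℝ) = ‖x‖⁻¹ := by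
        rw [← Real.rpow_mul hn.le]; norm_num [Real.rpow_neg_one]
      simp only [Function.comp, this]
      rw [div_eq_mul_inv, mul_assoc]
      gcongr
      exact hB x hx.1
    have : ContinuousWithinAt (fun w => ‖lmF f ε w‖) (Metric.closedBall 0 r \ {0}) 0 := by
      unfold ContinuousWithinAt; simpa only [hz] using key
    exact (continuousWithinAt_sdiff_self).mp this
  · have hn : ‖w‖ ≠ 0 := norm_ne_zero_iff.mpr h0
    have hn' : ‖-w‖ ≠ 0 := by simpa using h0
    have hc : ContinuousWithinAt (fun w => ‖f w‖ / ‖w‖ *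
      Real.exp (-(ε * (‖w‖ ^ (-(1/4) : ℝ) * Real.cos (Real.arccos ((-w).re / ‖-w‖) * (1/4))))))
      (Metric.closedBall 0 r) w := by
      apply ContinuousWithinAt.mul
      · exact (hf w hw).norm.div continuous_norm.continuousWithinAt hn
      · apply ContinuousAt.continuousWithinAt
        have k1 : ContinuousAt (fun w : ℂ => ‖w‖ ^ (-(1/4) : ℝ)) w :=
          continuous_norm.continuousAt.rpow_const (Or.inl hn)
        have k2 : ContinuousAt (fun w : ℂ => (-w).re / ‖-w‖) w :=
          ContinuousAt.div (Complex.continuous_re.comp continuous_neg).continuousAt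
            (continuous_norm.comp continuous_neg).continuousAt hn'
        have k3 : ContinuousAt (fun w : ℂ => Real.arccos ((-w).re / ‖-w‖)) w :=
          ContinuousAt.comp (g := Real.arccos) Real.continuous_arccos.continuousAt k2
        have k4 : ContinuousAt
            (fun w : ℂ => Real.cos (Real.arccos ((-w).re / ‖-w‖) * (1/4))) w :=
          ContinuousAt.comp (g := Real.cos) Real.continuous_cos.continuousAt (k3.mul_const _)
        exact ContinuousAt.comp (g := Real.exp) Real.continuous_exp.continuousAt
          (((k1.mul k4).const_mul ε).neg)
    refine hc.congr_of_eventuallyEq ?_ (lmF_norm f ε w h0)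
    filter_upwards [mem_nhdsWithin_of_mem_nhds (isOpen_ne.mem_nhds h0)] with x hx
    exact lmF_norm f ε x hx

/-- Phragmén–Lindelöf type estimate. -/
lemma lm_PL (f : ℂ → ℂ) (r M : ℝ) (hr : 0 < r) (hM : 0 ≤ M)
    (hf : ContinuousOn f (Metric.closedBall 0 r))
    (hE : ∀ w ∈ Metric.closedBall (0:ℂ) r, ‖f w‖ ≤ M * ‖w‖ ∨
      (w ∈ Metric.ball (0:ℂ) r ∧ AnalyticAt ℂ f w))
    (hray : ∀ t : ℝ, 0 ≤ t → t ≤ r → ‖f t‖ ≤ M * t) :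
    ∀ w ∈ Metric.closedBall (0:ℂ) r, ‖f w‖ ≤ M * ‖w‖ := by
  have main : ∀ ε : ℝ, 0 < ε → ∀ w ∈ Metric.closedBall (0:ℂ) r, ‖lmF f ε w‖ ≤ M := by
    intro ε hε
    by_contra! hcon
    obtain ⟨w₁, hw₁, hlt⟩ := hcon
    have hcont := lmF_cont f ε hε r hf
    obtain ⟨w₂, hw₂, hmax⟩ := (isCompact_closedBall (0:ℂ) r).exists_isMaxOn ⟨w₁, hw₁⟩ hcont
    set m := ‖lmF f ε w₂‖ with hm
    have hmM : M < m := hlt.trans_le (hmax hw₁)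
    set A : Set ℂ := Metric.closedBall 0 r ∩ (fun w => ‖lmF f ε w‖) ⁻¹' {m} with hA
    have hAcl : IsClosed A := hcont.preimage_isClosed_of_isClosed Metric.isClosed_closedBall isClosed_singleton
    have hAop : IsOpen A := by
      rw [isOpen_iff_mem_nhds]
      rintro w ⟨hw, hwm⟩
      have hwm' : ‖lmF f ε w‖ = m := hwm
      have hw0 : w ≠ 0 := by
        rintro rfl
        have : ‖lmF f ε 0‖ = 0 := by simp [lmF]
        linarith
      have hn : 0 < ‖w‖ := norm_pos_iff.mpr hw0
      have hnb : ¬ ‖f w‖ ≤ M * ‖w‖ := by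
        intro h
        have := lmF_norm_le' f ε hε w
        have h2 : ‖f w‖ / ‖w‖ ≤ M := by rw [div_le_iff₀ hn]; exact h
        linarith
      obtain ⟨hwb, han⟩ := (hE w hw).resolve_left hnb
      have hsl : -w ∈ Complex.slitPlane := by
        by_contra hns
        rw [Complex.mem_slitPlane_iff] at hns
        push Not at hns
        have h1 : 0 ≤ w.re := by simpa using hns.1
        have h2 : w.im = 0 := by simpa using hns.2
        have h3 : w = (w.re : ℂ) := by apply Complex.ext <;> simp [h2]
        have h4 : ‖w‖ = w.re := by rw [h3]; simp [abs_of_nonneg h1]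
        apply hnb
        rw [h4, h3]
        simp only [Complex.ofReal_re]
        apply hray _ h1
        rw [← h4]; simpa using hw
      have hball : ∀ᶠ z in 𝓝 w, z ∈ Metric.closedBall (0:ℂ) r :=
        Filter.mem_of_superset (Metric.isOpen_ball.mem_nhds hwb) Metric.ball_subset_closedBall
      have hd : ∀ᶠ z in 𝓝 w, DifferentiableAt ℂ (lmF f ε) z := by
        have hs : ∀ᶠ z in 𝓝 w, -z ∈ Complex.slitPlane :=
          continuous_neg.continuousAt.eventually (Complex.isOpen_slitPlane.mem_nhds hsl)
        filter_upwards [han.eventually_analyticAt, hs, isOpen_ne.mem_nhds hw0] with z h1 h2 h3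
        unfold lmF
        have h4 : DifferentiableAt ℂ (fun w : ℂ => (-w) ^ ((-(1/4) : ℝ) : ℂ)) z :=
          DifferentiableAt.cpow (by fun_prop) (by fun_prop) h2
        exact (h1.differentiableAt.div differentiableAt_id h3).mul ((h4.const_mul _).cexp)
      have hlm : IsLocalMax (norm ∘ lmF f ε) w := by
        filter_upwards [hball] with z hz
        simp only [Function.comp]
        rw [hwm']; exact hmax hz
      filter_upwards [hball, Complex.norm_eventually_eq_of_isLocalMax hd hlm] with z h1 h2
      exact ⟨h1, by simp only [mem_preimage, mem_singleton_iff]; rw [h2, hwm']⟩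
    have huniv := IsClopen.eq_univ ⟨hAcl, hAop⟩ ⟨w₂, hw₂, rfl⟩
    have : (0:ℂ) ∈ A := huniv ▸ mem_univ _
    have h0 : ‖lmF f ε 0‖ = m := this.2
    simp [lmF] at h0
    linarith
  intro w hw
  by_cases hw0 : w = 0
  · subst hw0
    simpa using hray 0 le_rfl hr.le
  have hn : 0 < ‖w‖ := norm_pos_iff.mpr hw0
  rw [← div_le_iff₀ hn]
  have hlim : Tendsto (fun ε : ℝ => ‖lmF f ε w‖) (𝓝[>] 0) (𝓝 (‖f w‖ / ‖w‖)) := by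
    have hc : Continuous (fun ε : ℝ => ‖lmF f ε w‖) := by unfold lmF; fun_prop
    have := (hc.tendsto 0).mono_left (nhdsWithin_le_nhds (s := Ioi 0))
    simpa [lmF] using this
  refine le_of_tendsto hlim ?_
  filter_upwards [self_mem_nhdsWithin] with ε hε
  exact main ε hε w hw

lemma lm_lip (f : ℂ → ℂ) (z₀ : ℂ) (R M : ℝ) (hM0 : 0 ≤ M) (E : Set ℂ)
    (hEc : IsClosed (E ∩ Metric.closedBall z₀ R)) (hz₀ : z₀ ∈ E) (hR : 0 < R)
    (hM : ∀ z ∈ E ∩ Metric.closedBall z₀ R, ∀ w ∈ Metric.closedBall z₀ R,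
      ‖f w - f z‖ ≤ M * ‖w - z‖)
    (hf : ContinuousOn f (Metric.closedBall z₀ R))
    (han : ∀ w ∈ Metric.closedBall z₀ R, w ∉ E → AnalyticAt ℂ f w) :
    ∀ w₁ ∈ Metric.ball z₀ (R/2), ∀ w₂ ∈ Metric.ball z₀ (R/2),
      ‖f w₂ - f w₁‖ ≤ (2 * M) * ‖w₂ - w₁‖ := by
  have hsub : Metric.ball z₀ (R/2) ⊆ Metric.closedBall z₀ R :=
    (Metric.ball_subset_ball (by linarith)).trans Metric.ball_subset_closedBall
  have hder : ∀ w ∈ Metric.ball z₀ (R/2), w ∉ E → ‖deriv f w‖ ≤ 2 * M := by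
    intro w hw hwE
    have hcomp : IsCompact (E ∩ Metric.closedBall z₀ R) :=
      (isCompact_closedBall z₀ R).of_isClosed_subset hEc inter_subset_right
    have hz₀' : z₀ ∈ E ∩ Metric.closedBall z₀ R := ⟨hz₀, Metric.mem_closedBall_self hR.le⟩
    obtain ⟨z, hz, hd⟩ := hcomp.exists_infDist_eq_dist ⟨z₀, hz₀'⟩ w
    set d := dist w z with hdd
    have hdpos : 0 < d := dist_pos.mpr (fun h => hwE (h ▸ hz.1))
    have hdle : d ≤ dist w z₀ := hd ▸ Metric.infDist_le_dist_of_mem hz₀'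
    have hwR : dist w z₀ < R / 2 := hw
    have hcb : Metric.closedBall w d ⊆ Metric.closedBall z₀ R := by
      intro v hv
      have : dist v w ≤ d := hv
      have := dist_triangle v w z₀
      simp only [Metric.mem_closedBall]; linarith
    have hoff : ∀ v ∈ Metric.ball w d, v ∉ E := by
      intro v hv hvE
      have h1 : dist v w < d := hv
      have h2 : Metric.infDist w (E ∩ Metric.closedBall z₀ R) ≤ dist w v :=
        Metric.infDist_le_dist_of_mem ⟨hvE, hcb (Metric.ball_subset_closedBall hv)⟩
      rw [dist_comm] at h2
      linarith
    have hdc : DiffContOnCl ℂ (fun v => f v - f z) (Metric.ball w d) := by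
      refine ⟨fun v hv => ?_, ?_⟩
      · exact ((han v (hcb (Metric.ball_subset_closedBall hv)) (hoff v hv)).differentiableAt.sub_const
          _).differentiableWithinAt
      · exact (hf.mono (Metric.closure_ball_subset_closedBall.trans hcb)).sub continuousOn_const
    have hbd : ∀ v ∈ Metric.sphere w d, ‖f v - f z‖ ≤ M * (2 * d) := by
      intro v hv
      refine (hM z hz v (hcb (Metric.sphere_subset_closedBall hv))).trans ?_
      gcongr
      rw [← dist_eq_norm]
      have h1 : dist v w = d := hv
      have := dist_triangle v w z
      linarith
    have := Complex.norm_deriv_le_of_forall_mem_sphere_norm_le hdpos hdc hbd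
    rw [deriv_sub_const] at this
    refine this.trans (le_of_eq ?_)
    field_simp
  intro w₁ h₁ w₂ h₂
  have hseg : segment ℝ w₁ w₂ ⊆ Metric.ball z₀ (R/2) := (convex_ball z₀ (R/2)).segment_subset h₁ h₂
  by_cases hE : ∃ z ∈ segment ℝ w₁ w₂, z ∈ E
  · obtain ⟨z, hzs, hzE⟩ := hE
    have hz : z ∈ E ∩ Metric.closedBall z₀ R := ⟨hzE, hsub (hseg hzs)⟩
    have a1 := hM z hz w₁ (hsub h₁)
    have a2 := hM z hz w₂ (hsub h₂)
    have a3 := dist_add_dist_of_mem_segment hzs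
    simp only [dist_eq_norm] at a3
    have a4 : ‖f w₂ - f w₁‖ ≤ ‖f w₂ - f z‖ + ‖f w₁ - f z‖ := by
      have := norm_sub_le (f w₂ - f z) (f w₁ - f z)
      simpa using this
    rw [norm_sub_rev w₂ w₁, ← a3]
    rw [norm_sub_rev w₂ z] at a2
    nlinarith [norm_nonneg (w₁ - z), norm_nonneg (z - w₂),
      mul_nonneg hM0 (norm_nonneg (w₁ - z)), mul_nonneg hM0 (norm_nonneg (z - w₂))]
  · push Not at hE
    exact Convex.norm_image_sub_le_of_norm_hasDerivWithin_le (f' := deriv f)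
      (s := segment ℝ w₁ w₂)
      (fun v hv => (han v (hsub (hseg hv)) (hE v hv)).differentiableAt.hasDerivAt.hasDerivWithinAt)
      (fun v hv => hder v (hseg hv) (hE v hv)) (convex_segment _ _)
      (left_mem_segment ℝ _ _) (right_mem_segment ℝ _ _)

lemma lm_diff (f : ℂ → ℂ) (z c : ℂ) (s : Set ℂ) (hs : s ∈ 𝓝 z) (K : NNReal)
    (hL : LipschitzOnWith K f s)
    (hG : ∀ h : ℂ, Tendsto (fun ε : ℝ => (ε : ℂ)⁻¹ * (f (z + (ε : ℂ) * h) - f z)) (𝓝[>] 0)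
      (𝓝 (h * c))) : DifferentiableAt ℂ f z := by
  obtain ⟨g, hg, hfg⟩ := hL.extend_finite_dimension
  have hev : f =ᶠ[𝓝 z] g := by filter_upwards [hs] with x hx using hfg hx
  have hz : f z = g z := hev.eq_of_nhds
  have hG' : ∀ h : ℂ, Tendsto (fun ε : ℝ => ε⁻¹ • (g (z + ε • h) - g z)) (𝓝[>] 0)
      (𝓝 (h * c)) := by
    intro h
    refine (hG h).congr' ?_
    have : Tendsto (fun ε : ℝ => z + ε • h) (𝓝[>] 0) (𝓝 z) := by
      have : Continuous (fun ε : ℝ => z + ε • h) := by fun_prop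
      simpa using (this.tendsto 0).mono_left nhdsWithin_le_nhds
    filter_upwards [this.eventually hev] with ε hε
    rw [← hε, ← hz]
    simp
  have hline : ∀ h : ℂ, HasLineDerivAt ℝ g (h * c) z h := by
    intro h
    unfold HasLineDerivAt
    have r1 : HasDerivWithinAt (fun t : ℝ => g (z + t • h)) (h * c) (Ioi 0) 0 := by
      rw [hasDerivWithinAt_iff_tendsto_slope' (by simp)]
      refine (hG' h).congr fun ε => ?_
      simp [slope]
    have r2 : HasDerivWithinAt (fun t : ℝ => g (z + t • h)) (h * c) (Iio 0) 0 := by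
      rw [hasDerivWithinAt_iff_tendsto_slope' (by simp)]
      have hn : Tendsto (fun t : ℝ => -t) (𝓝[<] 0) (𝓝[>] 0) := by
        simpa using tendsto_neg_nhdsLT (a := (0:ℝ))
      have := ((hG' (-h)).comp hn).neg
      simp only [neg_mul, neg_neg] at this
      refine this.congr fun ε => ?_
      simp [slope, Function.comp]
    have r3 := r1.Ici_of_Ioi.union r2.Iic_of_Iio
    rwa [union_comm, Iic_union_Ici, hasDerivWithinAt_univ] at r3
  have hfd : HasFDerivAt g ((c • (1 : ℂ →L[ℂ] ℂ)).restrictScalars ℝ) z :=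
    hg.hasFDerivAt_of_hasLineDerivAt_of_closure (s := univ) (by simp) (fun v _ => by
      simpa [mul_comm] using hline v)
  have hd : DifferentiableAt ℂ g z := by
    rw [differentiableAt_iff_restrictScalars ℝ hfd.differentiableAt]
    exact ⟨_, hfd.fderiv.symm⟩
  exact hd.congr_of_eventuallyEq hev

/-- A continuous function, Gateaux differentiable everywhere with complex-linear Gateaux
derivative, is holomorphic. -/
theorem lm_main (f : ℂ → ℂ) (D : Set ℂ) (hD : IsOpen D) (hf : ContinuousOn f D)
    (hG : ∀ z ∈ D, ∃ c : ℂ, ∀ h : ℂ,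
      Tendsto (fun ε : ℝ => (ε : ℂ)⁻¹ * (f (z + (ε : ℂ) * h) - f z)) (𝓝[>] 0) (𝓝 (h * c))) :
    ∀ z ∈ D, AnalyticAt ℂ f z := by
  by_contra! hcon
  obtain ⟨z₁, hz₁D, hz₁⟩ := hcon
  set E : Set ℂ := {z | ¬ AnalyticAt ℂ f z} with hEdef
  have hEcl : IsClosed E := by
    have := (isOpen_analyticAt ℂ f).isClosed_compl
    exact this
  obtain ⟨η, hη, hηD⟩ := Metric.isOpen_iff.mp hD z₁ hz₁D
  set ρ := η / 4 with hρdef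
  have hρ : 0 < ρ := by positivity
  have hρD : Metric.closedBall z₁ (2 * ρ) ⊆ D :=
    (Metric.closedBall_subset_ball (by linarith)).trans hηD
  set K : Set ℂ := E ∩ Metric.closedBall z₁ ρ with hKdef
  have hKcl : IsClosed K := hEcl.inter Metric.isClosed_closedBall
  have hKD : K ⊆ D := fun z hz =>
    hρD (Metric.closedBall_subset_closedBall (by linarith) hz.2)
  have : CompleteSpace K := hKcl.completeSpace_coe
  set V : Set ℂ := {1, -1, Complex.I, -Complex.I} with hV
  have hVfin : V.Finite := by simp [hV]
  have hVn : ∀ v ∈ V, ‖v‖ = 1 := by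
    intro v hv
    simp only [hV, mem_insert_iff, mem_singleton_iff] at hv
    rcases hv with rfl | rfl | rfl | rfl <;> simp
  let A : ℕ → Set K := fun n => {z | ∀ v ∈ V, ∀ t ∈ Icc (0:ℝ) (ρ / (n + 1)),
    ‖f (z + t * v) - f z‖ ≤ n * t}
  have hshift : ∀ z ∈ K, ∀ v ∈ V, ∀ (n : ℕ), ∀ t ∈ Icc (0:ℝ) (ρ / (n + 1)), z + t * v ∈ D := by
    intro z hz v hv n t ht
    apply hρD
    have h1 : dist z z₁ ≤ ρ := hz.2
    have h2 : t ≤ ρ := ht.2.trans (div_le_self hρ.le (by linarith [n.cast_nonneg (α := ℝ)]))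
    rw [Metric.mem_closedBall]
    have h3 : dist (z + t * v) z = t := by
      rw [dist_eq_norm]; simp [hVn v hv, abs_of_nonneg ht.1]
    linarith [dist_triangle (z + t * v) z z₁]
  have hAcl : ∀ n, IsClosed (A n) := by
    intro n
    simp only [A, ofPred_forall]
    refine isClosed_iInter fun v => isClosed_iInter fun hv => isClosed_iInter fun t =>
      isClosed_iInter fun ht => ?_
    refine isClosed_le (Continuous.norm (Continuous.sub ?_ ?_)) continuous_const
    · exact hf.comp_continuous (by fun_prop) (fun z => hshift z z.2 v hv n t ht)
    · exact hf.comp_continuous (by fun_prop) (fun z => hKD z.2)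
  have hAun : ⋃ n, A n = univ := by
    rw [eq_univ_iff_forall]
    rintro ⟨z, hz⟩
    rw [mem_iUnion]
    obtain ⟨c, hc⟩ := hG z (hKD hz)
    have hev : ∀ v ∈ V, ∀ᶠ n : ℕ in atTop, ∀ t ∈ Icc (0:ℝ) (ρ / (n + 1)),
        ‖f (z + t * v) - f z‖ ≤ n * t := by
      intro v hv
      have h1 := (hc v).norm.eventually (gt_mem_nhds (lt_add_one ‖v * c‖))
      obtain ⟨δ, hδ, h2⟩ := mem_nhdsGT_iff_exists_Ioo_subset.mp h1
      have hδ : 0 < δ := hδ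
      have h3 : Tendsto (fun n : ℕ => ρ / ((n:ℝ) + 1)) atTop (𝓝 0) :=
        tendsto_const_nhds.div_atTop
          (tendsto_atTop_add_const_right _ _ tendsto_natCast_atTop_atTop)
      filter_upwards [h3.eventually (gt_mem_nhds hδ),
        eventually_ge_atTop ⌈‖v * c‖ + 1⌉₊] with n hn1 hn2 t ht
      have hn3 : ‖v * c‖ + 1 ≤ n := (Nat.le_ceil _).trans (by exact_mod_cast hn2)
      rcases ht.1.eq_or_lt with h0 | h0
      · simp [← h0]
      · have h4 : ‖(t:ℂ)⁻¹ * (f (z + (t:ℂ) * v) - f z)‖ < ‖v * c‖ + 1 :=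
          h2 ⟨h0, ht.2.trans_lt hn1⟩
        rw [norm_mul, norm_inv, Complex.norm_real, Real.norm_of_nonneg ht.1,
          inv_mul_lt_iff₀ h0] at h4
        nlinarith
    obtain ⟨n, hn⟩ := ((eventually_all_finite hVfin).mpr hev).exists
    exact ⟨n, hn⟩
  have hdense := dense_iUnion_interior_of_closed hAcl hAun
  have hz₁K : z₁ ∈ K := ⟨hz₁, Metric.mem_closedBall_self hρ.le⟩
  obtain ⟨z₀', hz₀b, hz₀i⟩ := hdense.inter_open_nonempty ((↑) ⁻¹' Metric.ball z₁ ρ)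
    (Metric.isOpen_ball.preimage continuous_subtype_val) ⟨⟨z₁, hz₁K⟩, Metric.mem_ball_self hρ⟩
  obtain ⟨n, hn⟩ := mem_iUnion.mp hz₀i
  obtain ⟨z₀, hz₀⟩ := z₀'
  obtain ⟨s, hs, hsA⟩ := Metric.mem_nhds_iff.mp (mem_interior_iff_mem_nhds.mp hn)
  have hz₀b : dist z₀ z₁ < ρ := hz₀b
  set δ := ρ / ((n:ℝ) + 1) with hδdef
  have hδ : 0 < δ := by positivity
  obtain ⟨R, hR0, hR⟩ : ∃ R, 0 < R ∧ R < min ((ρ - dist z₀ z₁) / 2) (min (s / 2) (δ / 4)) := by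
    apply exists_between
    have : 0 < ρ - dist z₀ z₁ := by linarith
    positivity
  simp only [lt_min_iff] at hR
  obtain ⟨hR1, hR2, hR3⟩ := hR
  have hBsub : Metric.closedBall z₀ (2 * R) ⊆ Metric.closedBall z₁ ρ := by
    intro w hw
    have : dist w z₀ ≤ 2 * R := hw
    rw [Metric.mem_closedBall]
    linarith [dist_triangle w z₀ z₁]
  have hBD : Metric.closedBall z₀ (2 * R) ⊆ D := fun w hw =>
    hρD (Metric.closedBall_subset_closedBall (by linarith) (hBsub hw))
  have hEA : ∀ z ∈ E ∩ Metric.closedBall z₀ (2 * R), ∀ v ∈ V, ∀ t ∈ Icc (0:ℝ) δ,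
      ‖f (z + t * v) - f z‖ ≤ n * t := by
    intro z hz
    have hzK : z ∈ K := ⟨hz.1, hBsub hz.2⟩
    have h1 : (⟨z, hzK⟩ : K) ∈ Metric.ball (⟨z₀, hz₀⟩ : K) s := by
      rw [Metric.mem_ball, Subtype.dist_eq]
      have : dist z z₀ ≤ 2 * R := hz.2
      simp only; linarith
    exact hsA h1
  have hre : ∀ z ∈ E ∩ Metric.closedBall z₀ (2 * R), ∀ a : ℝ, |a| ≤ δ →
      ‖f (z + a) - f z‖ ≤ n * |a| := by
    intro z hz a ha
    rcases le_total 0 a with h | h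
    · have := hEA z hz 1 (by simp [hV]) a ⟨h, by rwa [abs_of_nonneg h] at ha⟩
      rw [abs_of_nonneg h]; simpa using this
    · have := hEA z hz (-1) (by simp [hV]) (-a) ⟨by linarith, by rwa [abs_of_nonpos h] at ha⟩
      rw [abs_of_nonpos h]; simpa using this
  have him : ∀ z ∈ E ∩ Metric.closedBall z₀ (2 * R), ∀ a : ℝ, |a| ≤ δ →
      ‖f (z + a * Complex.I) - f z‖ ≤ n * |a| := by
    intro z hz a ha
    rcases le_total 0 a with h | h
    · have := hEA z hz Complex.I (by simp [hV]) a ⟨h, by rwa [abs_of_nonneg h] at ha⟩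
      rw [abs_of_nonneg h]; simpa using this
    · have := hEA z hz (-Complex.I) (by simp [hV]) (-a)
        ⟨by linarith, by rwa [abs_of_nonpos h] at ha⟩
      rw [abs_of_nonpos h]; simpa using this
  have hlipE : ∀ z ∈ E ∩ Metric.closedBall z₀ (2 * R), ∀ w ∈ E ∩ Metric.closedBall z₀ (2 * R),
      ‖f w - f z‖ ≤ (2 * n) * ‖w - z‖ := by
    intro z hz w hw
    have hd : ‖w - z‖ ≤ δ := by
      rw [← dist_eq_norm]
      have h1 : dist z z₀ ≤ 2 * R := hz.2
      have h2 : dist w z₀ ≤ 2 * R := hw.2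
      linarith [dist_triangle_right w z z₀]
    have hr := Complex.abs_re_le_norm (w - z)
    have hi := Complex.abs_im_le_norm (w - z)
    have k1 := hre z hz (w - z).re (hr.trans hd)
    have k2 := him w hw (-(w - z).im) (by rw [abs_neg]; exact hi.trans hd)
    have k3 : w + ((-(w - z).im : ℝ) : ℂ) * Complex.I = z + ((w - z).re : ℂ) := by
      apply Complex.ext <;> simp
    rw [k3, abs_neg] at k2
    have k4 : f w - f z = (f (z + ((w - z).re : ℂ)) - f z) - (f (z + ((w - z).re : ℂ)) - f w) := by
      ring
    rw [k4]
    refine (norm_sub_le _ _).trans ?_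
    have hn0 : (0:ℝ) ≤ n := n.cast_nonneg
    nlinarith [mul_le_mul_of_nonneg_left hr hn0, mul_le_mul_of_nonneg_left hi hn0]
  have hfB : ContinuousOn f (Metric.closedBall z₀ (2 * R)) := hf.mono hBD
  obtain ⟨B, hB⟩ := (isCompact_closedBall z₀ (2 * R)).exists_bound_of_continuousOn hfB
  set M : ℝ := max (2 * n) (2 * B / R) with hM
  have hM1 : 2 * (n:ℝ) ≤ M := le_max_left _ _
  have hM2 : 2 * B / R ≤ M := le_max_right _ _
  have hn0 : (0:ℝ) ≤ n := n.cast_nonneg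
  have hM0 : 0 ≤ M := by linarith
  have hPL : ∀ z ∈ E ∩ Metric.closedBall z₀ R, ∀ w ∈ Metric.closedBall (0:ℂ) R,
      ‖f (z + w) - f z‖ ≤ M * ‖w‖ := by
    intro z hz
    have hz2 : z ∈ E ∩ Metric.closedBall z₀ (2 * R) :=
      ⟨hz.1, Metric.closedBall_subset_closedBall (by linarith) hz.2⟩
    have hmaps : ∀ w ∈ Metric.closedBall (0:ℂ) R, z + w ∈ Metric.closedBall z₀ (2 * R) := by
      intro w hw
      have h1 : ‖w‖ ≤ R := by simpa using hw
      have h2 : dist z z₀ ≤ R := hz.2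
      rw [Metric.mem_closedBall]
      have h3 : dist (z + w) z = ‖w‖ := by simp [dist_eq_norm]
      linarith [dist_triangle (z + w) z z₀]
    refine lm_PL (fun w => f (z + w) - f z) R M hR0 hM0 ?_ ?_ ?_
    · exact (hfB.comp (by fun_prop) hmaps).sub continuousOn_const
    · intro w hw
      by_cases hwE : z + w ∈ E
      · left
        have := hlipE z hz2 (z + w) ⟨hwE, hmaps w hw⟩
        rw [add_sub_cancel_left] at this
        refine this.trans ?_
        gcongr
      · have han : AnalyticAt ℂ f (z + w) := by simpa [hEdef] using hwE
        by_cases hwb : w ∈ Metric.ball (0:ℂ) R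
        · right
          refine ⟨hwb, ?_⟩
          have : AnalyticAt ℂ (fun w => f (z + w)) w :=
            AnalyticAt.fun_comp han (by fun_prop)
          exact this.sub analyticAt_const
        · left
          have hwR : R ≤ ‖w‖ := by simpa using hwb
          have h1 := hB _ (hmaps w hw)
          have h2 := hB z hz2.2
          have h3 := norm_sub_le (f (z + w)) (f z)
          have h4 : 2 * B ≤ M * R := by rwa [div_le_iff₀ hR0] at hM2
          have h5 : M * R ≤ M * ‖w‖ := by gcongr
          linarith
    · intro t ht0 htR
      have := hre z hz2 t (by rw [abs_of_nonneg ht0]; linarith)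
      rw [abs_of_nonneg ht0] at this
      refine this.trans ?_
      gcongr
      linarith
  have hsub2 : Metric.closedBall z₀ (R/2) ⊆ Metric.closedBall z₀ (2 * R) :=
    Metric.closedBall_subset_closedBall (by linarith)
  have hlip := lm_lip f z₀ (R/2) M hM0 E (hEcl.inter Metric.isClosed_closedBall) hz₀.1
    (by positivity) (by
      intro z hz w hw
      have h1 : dist z z₀ ≤ R/2 := hz.2
      have h2 : dist w z₀ ≤ R/2 := hw
      have := hPL z ⟨hz.1, Metric.closedBall_subset_closedBall (by linarith) hz.2⟩ (w - z) (by
        rw [mem_closedBall_zero_iff, ← dist_eq_norm]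
        linarith [dist_triangle_right w z z₀])
      simpa using this) (hfB.mono hsub2) (by
      intro w _ hwE
      simpa [hEdef] using hwE)
  have hLip : LipschitzOnWith ⟨2 * M, by positivity⟩ f (Metric.ball z₀ (R/2/2)) := by
    apply LipschitzOnWith.of_dist_le_mul
    intro x hx y hy
    rw [dist_eq_norm, dist_eq_norm]
    exact hlip y hy x hx
  have hdiff : DifferentiableOn ℂ f (Metric.ball z₀ (R/2/2)) := by
    intro z hz
    have hzD : z ∈ D := hBD (hsub2 ((Metric.ball_subset_ball (by linarith)).trans
      Metric.ball_subset_closedBall hz))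
    obtain ⟨c, hc⟩ := hG z hzD
    exact (lm_diff f z c _ (Metric.isOpen_ball.mem_nhds hz) _ hLip hc).differentiableWithinAt
  exact hz₀.1 (hdiff.analyticAt (Metric.ball_mem_nhds z₀ (by positivity)))

lemma xi_add_smul (a b : ℂ) (p h : ℝ × ℝ × ℝ) (t : ℝ) :
    xi a b (p + t • h) = xi a b p + t * xi a b h := by
  simp only [xi, Prod.fst_add, Prod.snd_add, Prod.smul_fst, Prod.smul_snd, smul_eq_mul,
    Complex.ofReal_add, Complex.ofReal_mul]
  ring

lemma xi_eq_zero_mem (a b : ℂ) (p : ℝ × ℝ × ℝ) (h : xi a b p = 0) : p ∈ lineL a b := by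
  have h1 := congrArg Complex.re h
  have h2 := congrArg Complex.im h
  simp [xi] at h1 h2
  exact ⟨h1, h2⟩

lemma im_ne_of_not_range {a : ℂ} (h : a ∉ Set.range ((↑) : ℝ → ℂ)) : a.im ≠ 0 := by
  intro h0
  exact h ⟨a.re, by apply Complex.ext <;> simp [h0]⟩

lemma xi_section (a b : ℂ)
    (hab : a ∉ Set.range ((↑) : ℝ → ℂ) ∨ b ∉ Set.range ((↑) : ℝ → ℂ)) :
    ∃ σ : ℂ →L[ℝ] ℝ × ℝ × ℝ, ∀ w, xi a b (σ w) = w := by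
  rcases hab with h | h
  · have h0 := im_ne_of_not_range h
    refine ⟨(Complex.reCLM - (a.re / a.im) • Complex.imCLM).prod
      ((a.im⁻¹ • Complex.imCLM).prod 0), fun w => ?_⟩
    apply Complex.ext <;> simp [xi] <;> field_simp <;> ring
  · have h0 := im_ne_of_not_range h
    refine ⟨(Complex.reCLM - (b.re / b.im) • Complex.imCLM).prod
      (ContinuousLinearMap.prod 0 (b.im⁻¹ • Complex.imCLM)), fun w => ?_⟩
    apply Complex.ext <;> simp [xi] <;> field_simp <;> ring

lemma scalar_main (a b : ℂ) (Ω : Set (ℝ × ℝ × ℝ)) (hΩo : IsOpen Ω)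
    (hconv : ConvexInDirection Ω (lineL a b))
    (hab : a ∉ Set.range ((↑) : ℝ → ℂ) ∨ b ∉ Set.range ((↑) : ℝ → ℂ))
    (U : ℝ × ℝ × ℝ → ℂ) (hU : ContinuousOn U Ω)
    (hG : ∀ p ∈ Ω, ∃ c : ℂ, ∀ h : ℝ × ℝ × ℝ,
      Tendsto (fun ε : ℝ => (ε : ℂ)⁻¹ * (U (p + ε • h) - U p)) (𝓝[>] 0) (𝓝 (xi a b h * c))) :
    ∃ F : ℂ → ℂ, AnalyticOnNhd ℂ F (xi a b '' Ω) ∧ ∀ p ∈ Ω, U p = F (xi a b p) := by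
  obtain ⟨σ, hσ⟩ := xi_section a b hab
  -- `U` is constant on the fibres of `xi`
  have hfib : ∀ p ∈ Ω, ∀ q ∈ Ω, xi a b p = xi a b q → U q = U p := by
    intro p hp q hq hpq
    have hv : xi a b (q - p) = 0 := by
      have := xi_add_smul a b q p (-1)
      have h2 : q - p = q + (-1 : ℝ) • p := by simp [sub_eq_add_neg]
      rw [h2, this, hpq]; push_cast; ring
    have hseg := hconv p hp q hq (xi_eq_zero_mem a b _ hv)
    have hmem : ∀ t ∈ Icc (0:ℝ) 1, p + t • (q - p) ∈ Ω := by
      intro t ht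
      apply hseg
      rw [segment_eq_image']
      exact ⟨t, ht, rfl⟩
    have hc : ContinuousOn (fun t : ℝ => U (p + t • (q - p))) (Icc 0 1) :=
      hU.comp (by fun_prop) hmem
    have hd : ∀ t ∈ Ico (0:ℝ) 1,
        HasDerivWithinAt (fun t : ℝ => U (p + t • (q - p))) 0 (Ici t) t := by
      intro t ht
      apply HasDerivWithinAt.Ici_of_Ioi
      rw [hasDerivWithinAt_iff_tendsto_slope' (by simp)]
      obtain ⟨c, hc⟩ := hG _ (hmem t ⟨ht.1, ht.2.le⟩)
      have h1 := hc (q - p)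
      rw [hv, zero_mul] at h1
      have h2 : Tendsto (fun s : ℝ => s - t) (𝓝[>] t) (𝓝[>] 0) := by
        refine tendsto_nhdsWithin_iff.mpr ⟨?_, ?_⟩
        · have : Continuous (fun s : ℝ => s - t) := by fun_prop
          simpa using (this.tendsto t).mono_left nhdsWithin_le_nhds
        · filter_upwards [self_mem_nhdsWithin] with s hs
          simpa using hs
      refine (h1.comp h2).congr fun s => ?_
      have h3 : p + t • (q - p) + (s - t) • (q - p) = p + s • (q - p) := by
        rw [sub_smul]; abel
      simp only [Function.comp, slope, vsub_eq_sub, h3]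
      rw [← Complex.ofReal_inv, ← smul_eq_mul, Complex.coe_smul]
    have := constant_of_has_deriv_right_zero hc hd 1 (by simp)
    simpa using this
  classical
  let F : ℂ → ℂ := fun w => if h : ∃ p ∈ Ω, xi a b p = w then U h.choose else 0
  have hF : ∀ p ∈ Ω, U p = F (xi a b p) := by
    intro p hp
    have hex : ∃ q ∈ Ω, xi a b q = xi a b p := ⟨p, hp, rfl⟩
    simp only [F, dif_pos hex]
    exact hfib _ hex.choose_spec.1 p hp hex.choose_spec.2
  refine ⟨F, ?_, hF⟩
  rintro _ ⟨p₀, hp₀, rfl⟩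
  set w₀ := xi a b p₀ with hw₀
  let τ : ℂ → ℝ × ℝ × ℝ := fun w => p₀ + σ (w - w₀)
  have hτc : Continuous τ := by fun_prop
  have hτx : ∀ w, xi a b (τ w) = w := by
    intro w
    have := xi_add_smul a b p₀ (σ (w - w₀)) 1
    rw [one_smul, hσ] at this
    simp only [τ]
    rw [this, ← hw₀]; push_cast; ring
  have hV : IsOpen (τ ⁻¹' Ω) := hΩo.preimage hτc
  have hw₀V : w₀ ∈ τ ⁻¹' Ω := by simpa [τ] using hp₀
  have han := lm_main (U ∘ τ) (τ ⁻¹' Ω) hV (hU.comp hτc.continuousOn fun _ h => h) (by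
    intro z hz
    obtain ⟨c, hc⟩ := hG (τ z) hz
    refine ⟨c, fun h => ?_⟩
    have := hc (σ h)
    rw [hσ] at this
    refine this.congr fun ε => ?_
    have e : τ z + ε • σ h = τ (z + ε * h) := by
      simp only [τ]
      rw [← map_smul, add_assoc, ← map_add, Complex.real_smul]
      congr 2; ring
    simp only [Function.comp, e]) w₀ hw₀V
  refine han.congr ?_
  filter_upwards [hV.mem_nhds hw₀V] with w hw
  simp only [Function.comp]
  rw [hF _ hw, hτx]

lemma HC_continuous_zeta (i2 i3 : HC) : Continuous (zeta i2 i3) := by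
  rw [continuous_induced_rng]
  simp only [Function.comp_def, zeta]
  simp
  refine ⟨?_, ?_, ?_, ?_⟩ <;> fun_prop

lemma HC_cont_coords : Continuous (fun q : HC => (q.re, q.imI, q.imJ, q.imK)) :=
  continuous_induced_dom

lemma HC_continuous_re : Continuous (fun q : HC => q.re) := continuous_fst.comp HC_cont_coords
lemma HC_continuous_imI : Continuous (fun q : HC => q.imI) :=
  (continuous_fst.comp continuous_snd).comp HC_cont_coords
lemma HC_continuous_imJ : Continuous (fun q : HC => q.imJ) :=
  (continuous_fst.comp (continuous_snd.comp continuous_snd)).comp HC_cont_coords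
lemma HC_continuous_imK : Continuous (fun q : HC => q.imK) :=
  (continuous_snd.comp (continuous_snd.comp continuous_snd)).comp HC_cont_coords

lemma continuous_c1 : Continuous c1 :=
  HC_continuous_re.sub (continuous_const.mul HC_continuous_imI)
lemma continuous_c2 : Continuous c2 :=
  HC_continuous_re.add (continuous_const.mul HC_continuous_imI)
lemma continuous_c3 : Continuous c3 :=
  (continuous_const.mul HC_continuous_imJ).neg.sub HC_continuous_imK
lemma continuous_c4 : Continuous c4 :=
  (continuous_const.mul HC_continuous_imJ).neg.add HC_continuous_imK

lemma HC_decomp (q : HC) : q = c1 q • e1 + c2 q • e2 + c3 q • e3 + c4 q • e4 := by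
  have hI := Complex.I_mul_I
  ext <;> simp [c1, c2, c3, c4, e1, e2, e3, e4] <;> grind

lemma zeta_add_smul (i2 i3 : HC) (p h : ℝ × ℝ × ℝ) (t : ℝ) :
    zeta i2 i3 (p + t • h) = zeta i2 i3 p + (t : ℂ) • zeta i2 i3 h := by
  ext <;> simp [zeta] <;> ring

lemma zeta_coords (a₁ a₂ b₁ b₂ : ℂ) (p : ℝ × ℝ × ℝ) :
    zeta (a₁ • e1 + a₂ • e2) (b₁ • e1 + b₂ • e2) p =
      xi a₁ b₁ p • e1 + xi a₂ b₂ p • e2 := by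
  ext <;> simp [zeta, xi, e1, e2] <;> ring

lemma c1_mul (u v : ℂ) (q : HC) : c1 ((u • e1 + v • e2) * q) = u * c1 q := by
  have hI := Complex.I_mul_I
  simp [c1, e1, e2]; grind
lemma c2_mul (u v : ℂ) (q : HC) : c2 ((u • e1 + v • e2) * q) = v * c2 q := by
  have hI := Complex.I_mul_I
  simp [c2, e1, e2]; grind
lemma c3_mul (u v : ℂ) (q : HC) : c3 ((u • e1 + v • e2) * q) = u * c3 q := by
  have hI := Complex.I_mul_I
  simp [c3, e1, e2]; grind
lemma c4_mul (u v : ℂ) (q : HC) : c4 ((u • e1 + v • e2) * q) = v * c4 q := by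
  have hI := Complex.I_mul_I
  simp [c4, e1, e2]; grind

lemma f1_lin (u v : ℂ) : f1 (u • e1 + v • e2) = u := by
  have hI := Complex.I_mul_I
  simp [f1, c1, c3, e1, e2]; grind
lemma f2_lin (u v : ℂ) : f2 (u • e1 + v • e2) = v := by
  have hI := Complex.I_mul_I
  simp [f2, c2, c4, e1, e2]; grind

lemma c1_lin (s : ℂ) (p q : HC) : c1 (s • (p - q)) = s * (c1 p - c1 q) := by
  simp [c1]; ring
lemma c2_lin (s : ℂ) (p q : HC) : c2 (s • (p - q)) = s * (c2 p - c2 q) := by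
  simp [c2]; ring
lemma c3_lin (s : ℂ) (p q : HC) : c3 (s • (p - q)) = s * (c3 p - c3 q) := by
  simp [c3]; ring
lemma c4_lin (s : ℂ) (p q : HC) : c4 (s • (p - q)) = s * (c4 p - c4 q) := by
  simp [c4]; ring

lemma component_main (a b : ℂ) (i2 i3 : HC) (Ω : Set (ℝ × ℝ × ℝ)) (hΩo : IsOpen Ω)
    (hconv : ConvexInDirection Ω (lineL a b))
    (hab : a ∉ Set.range ((↑) : ℝ → ℂ) ∨ b ∉ Set.range ((↑) : ℝ → ℂ))
    (Φ : HC → HC) (hΦ : RightGMonogenic i2 i3 Φ (zeta i2 i3 '' Ω))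
    (c : HC → ℂ) (hc : Continuous c)
    (hlin : ∀ (s : ℂ) (p q : HC), c (s • (p - q)) = s * (c p - c q))
    (hmul : ∀ (h : ℝ × ℝ × ℝ) (q : HC), c (zeta i2 i3 h * q) = xi a b h * c q) :
    ∃ F : ℂ → ℂ, AnalyticOnNhd ℂ F (xi a b '' Ω) ∧
      ∀ p ∈ Ω, c (Φ (zeta i2 i3 p)) = F (xi a b p) := by
  refine scalar_main a b Ω hΩo hconv hab (fun p => c (Φ (zeta i2 i3 p))) ?_ ?_
  · exact hc.comp_continuousOn
      (hΦ.1.comp (HC_continuous_zeta i2 i3).continuousOn (mapsTo_image _ _))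
  · intro p hp
    obtain ⟨Φ', h'⟩ := hΦ.2 _ (mem_image_of_mem _ hp)
    refine ⟨c Φ', fun h => ?_⟩
    have := (hc.tendsto _).comp (h' (zeta i2 i3 h) ⟨h, rfl⟩)
    rw [hmul] at this
    refine this.congr fun ε => ?_
    simp only [Function.comp, hlin, zeta_add_smul]

/-- Theorem 5: on a domain convex in the directions of `L₁` and `L₂`, every
right-G-monogenic map has the form `F₁(ξ₁)e₁ + F₂(ξ₂)e₂ + F₃(ξ₁)e₃ + F₄(ξ₂)e₄` with `F₁, F₃`
analytic on `D₁ = f₁(Ω_ζ)` and `F₂, F₄` analytic on `D₂ = f₂(Ω_ζ)`. -/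
theorem statement12 (a₁ a₂ b₁ b₂ : ℂ) (i2 i3 : HC)
    (hi2 : i2 = a₁ • e1 + a₂ • e2) (hi3 : i3 = b₁ • e1 + b₂ • e2)
    (hLI : LinIndep i2 i3)
    (Ω : Set (ℝ × ℝ × ℝ)) (hΩo : IsOpen Ω) (hΩc : IsConnected Ω)
    (hconv1 : ConvexInDirection Ω (lineL a₁ b₁)) (hconv2 : ConvexInDirection Ω (lineL a₂ b₂))
    (hab1 : a₁ ∉ Set.range ((↑) : ℝ → ℂ) ∨ b₁ ∉ Set.range ((↑) : ℝ → ℂ))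
    (hab2 : a₂ ∉ Set.range ((↑) : ℝ → ℂ) ∨ b₂ ∉ Set.range ((↑) : ℝ → ℂ))
    (Φ : HC → HC) (hΦ : RightGMonogenic i2 i3 Φ (zeta i2 i3 '' Ω)) :
    ∃ F1 F2 F3 F4 : ℂ → ℂ,
      AnalyticOnNhd ℂ F1 (f1 '' (zeta i2 i3 '' Ω)) ∧
      AnalyticOnNhd ℂ F3 (f1 '' (zeta i2 i3 '' Ω)) ∧
      AnalyticOnNhd ℂ F2 (f2 '' (zeta i2 i3 '' Ω)) ∧
      AnalyticOnNhd ℂ F4 (f2 '' (zeta i2 i3 '' Ω)) ∧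
      ∀ p ∈ Ω, Φ (zeta i2 i3 p) =
        F1 (xi a₁ b₁ p) • e1 + F2 (xi a₂ b₂ p) • e2 +
        F3 (xi a₁ b₁ p) • e3 + F4 (xi a₂ b₂ p) • e4 := by
  subst hi2 hi3
  have hD1 : f1 '' (zeta (a₁ • e1 + a₂ • e2) (b₁ • e1 + b₂ • e2) '' Ω) = xi a₁ b₁ '' Ω := by
    rw [image_image]
    exact image_congr fun p _ => by rw [zeta_coords, f1_lin]
  have hD2 : f2 '' (zeta (a₁ • e1 + a₂ • e2) (b₁ • e1 + b₂ • e2) '' Ω) = xi a₂ b₂ '' Ω := by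
    rw [image_image]
    exact image_congr fun p _ => by rw [zeta_coords, f2_lin]
  obtain ⟨F1, hF1, hF1'⟩ := component_main a₁ b₁ _ _ Ω hΩo hconv1 hab1 Φ hΦ c1 continuous_c1
    c1_lin (fun h q => by rw [zeta_coords, c1_mul])
  obtain ⟨F2, hF2, hF2'⟩ := component_main a₂ b₂ _ _ Ω hΩo hconv2 hab2 Φ hΦ c2 continuous_c2
    c2_lin (fun h q => by rw [zeta_coords, c2_mul])
  obtain ⟨F3, hF3, hF3'⟩ := component_main a₁ b₁ _ _ Ω hΩo hconv1 hab1 Φ hΦ c3 continuous_c3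
    c3_lin (fun h q => by rw [zeta_coords, c3_mul])
  obtain ⟨F4, hF4, hF4'⟩ := component_main a₂ b₂ _ _ Ω hΩo hconv2 hab2 Φ hΦ c4 continuous_c4
    c4_lin (fun h q => by rw [zeta_coords, c4_mul])
  rw [hD1, hD2]
  refine ⟨F1, F2, F3, F4, hF1, hF3, hF2, hF4, fun p hp => ?_⟩
  rw [← hF1' p hp, ← hF2' p hp, ← hF3' p hp, ← hF4' p hp]
  exact HC_decomp _

end
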